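/- arXiv:1410.6442 — 2 statements merged into one kernel-verified Lean document; each statement's English description precedes it below -/
import Mathlib

section
/- Let A, B, C be three non-collinear points in ℝ². If there exist three non-collinear points P₁, P₂, P₃ in the convex hull of {A, B, C} at which the distance sum function takes the same value (V(P₁) = V(P₂) = V(P₃)), then the triangle is equilateral: dist A B = dist B C = dist C A. -/
noncomputable def lineDist (P A B : EuclideanSpace ℝ (Fin 2)) : ℝ :=
  Metric.infDist P (affineSpan ℝ {A, B} : Set (EuclideanSpace ℝ (Fin 2)))

noncomputable def distSum (A B C P : EuclideanSpace ℝ (Fin 2)) : ℝ :=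
  lineDist P A B + lineDist P B C + lineDist P C A

/-- Twice the signed area of the triangle `A B P`. -/
def signedArea (A B P : EuclideanSpace ℝ (Fin 2)) : ℝ :=
  (B 0 - A 0) * (P 1 - A 1) - (B 1 - A 1) * (P 0 - A 0)

lemma signedArea_rotate (A B C : EuclideanSpace ℝ (Fin 2)) :
    signedArea B C A = signedArea A B C := by
  unfold signedArea; ring

lemma dist_sq_eq_coord (A B : EuclideanSpace ℝ (Fin 2)) :
    dist A B ^ 2 = (A 0 - B 0) ^ 2 + (A 1 - B 1) ^ 2 := by
  rw [EuclideanSpace.dist_eq, Real.sq_sqrt (by positivity)]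
  simp [Fin.sum_univ_two, Real.dist_eq, sq_abs]

lemma collinear_of_signedArea_eq_zero {A B P : EuclideanSpace ℝ (Fin 2)}
    (h : signedArea A B P = 0) : Collinear ℝ ({A, B, P} : Set (EuclideanSpace ℝ (Fin 2))) := by
  rcases eq_or_ne A B with rfl | hAB
  · simpa using collinear_pair ℝ A P
  have hd : dist A B ^ 2 ≠ 0 := pow_ne_zero 2 (dist_ne_zero.2 hAB)
  have hsq := dist_sq_eq_coord A B
  rw [collinear_iff_of_mem (p₀ := A) (by simp)]
  refine ⟨B - A, ?_⟩
  unfold signedArea at h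
  rintro p (rfl | rfl | rfl)
  · exact ⟨0, by simp⟩
  · exact ⟨1, by simp⟩
  · have ht := div_mul_cancel₀ ((B 0 - A 0) * (p 0 - A 0) + (B 1 - A 1) * (p 1 - A 1)) hd
    generalize ((B 0 - A 0) * (p 0 - A 0) + (B 1 - A 1) * (p 1 - A 1)) / dist A B ^ 2 = t at ht
    refine ⟨t, ?_⟩
    ext i
    fin_cases i <;> apply mul_left_cancel₀ hd <;>
      simp only [Fin.zero_eta, Fin.mk_one, vadd_eq_add, PiLp.add_apply, PiLp.smul_apply,
        PiLp.sub_apply, smul_eq_mul]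
    · linear_combination (p 0 - A 0) * hsq - (B 0 - A 0) * ht - (B 1 - A 1) * h
    · linear_combination (p 1 - A 1) * hsq - (B 1 - A 1) * ht + (B 0 - A 0) * h

lemma lineDist_eq_abs_signedArea_div {A B : EuclideanSpace ℝ (Fin 2)} (hAB : A ≠ B)
    (P : EuclideanSpace ℝ (Fin 2)) : lineDist P A B = |signedArea A B P| / dist A B := by
  have hpos : 0 < dist A B := dist_pos.2 hAB
  have hsq := dist_sq_eq_coord A B
  have hmem : ∀ t : ℝ, AffineMap.lineMap A B t ∈
      (affineSpan ℝ {A, B} : Set (EuclideanSpace ℝ (Fin 2))) :=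
    fun t => AffineMap.lineMap_mem_affineSpan_pair t A B
  unfold lineDist
  apply le_antisymm
  · refine (Metric.infDist_le_dist_of_mem (hmem
      (((B 0 - A 0) * (P 0 - A 0) + (B 1 - A 1) * (P 1 - A 1)) / dist A B ^ 2))).trans ?_
    refine abs_le_of_sq_le_sq' ?_ (by positivity) |>.2
    rw [div_pow, sq_abs, dist_sq_eq_coord P]
    simp only [AffineMap.lineMap_apply, vsub_eq_sub, vadd_eq_add, PiLp.add_apply,
      PiLp.smul_apply, PiLp.sub_apply, smul_eq_mul]
    have hne : (A 0 - B 0) ^ 2 + (A 1 - B 1) ^ 2 ≠ 0 := by rw [← hsq]; positivity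
    rw [hsq]
    apply le_of_eq
    unfold signedArea
    field_simp
    ring
  · refine (Metric.le_infDist ⟨_, hmem 0⟩).2 fun {Q} hQ => ?_
    obtain ⟨t, rfl⟩ := mem_affineSpan_pair_iff_exists_lineMap_eq.1 hQ
    rw [div_le_iff₀ hpos]
    refine abs_le_of_sq_le_sq ?_ (by positivity)
    rw [mul_pow, dist_sq_eq_coord P, hsq]
    simp only [AffineMap.lineMap_apply, vsub_eq_sub, vadd_eq_add, PiLp.add_apply,
      PiLp.smul_apply, PiLp.sub_apply, smul_eq_mul]
    unfold signedArea
    nlinarith [sq_nonneg ((B 0 - A 0) * (P 0 - (t * (B 0 - A 0) + A 0)) +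
      (B 1 - A 1) * (P 1 - (t * (B 1 - A 1) + A 1)))]

lemma signedArea_mul_nonneg_of_mem_convexHull {A B C P : EuclideanSpace ℝ (Fin 2)}
    (hP : P ∈ convexHull ℝ ({A, B, C} : Set (EuclideanSpace ℝ (Fin 2)))) :
    0 ≤ signedArea A B P * signedArea A B C := by
  have hconv : Convex ℝ {Q | 0 ≤ signedArea A B Q * signedArea A B C} := by
    intro x hx y hy a b ha hb hab
    have key : signedArea A B (a • x + b • y) = a * signedArea A B x + b * signedArea A B y := by
      obtain rfl : b = 1 - a := by linarith
      simp [signedArea]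
      ring
    simp only [Set.mem_ofPred_eq] at *
    rw [key]
    nlinarith [mul_nonneg ha hx, mul_nonneg hb hy]
  refine convexHull_min ?_ hconv hP
  rintro Q (rfl | rfl | rfl)
  · simp [signedArea]
  · simp [signedArea, mul_comm]
  · exact mul_self_nonneg (_ : ℝ)

lemma abs_signedArea_mul_of_mem_convexHull {A B C P : EuclideanSpace ℝ (Fin 2)}
    (hP : P ∈ convexHull ℝ ({A, B, C} : Set (EuclideanSpace ℝ (Fin 2)))) :
    |signedArea A B P| * signedArea A B C = signedArea A B P * |signedArea A B C| := by
  have h := signedArea_mul_nonneg_of_mem_convexHull hP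
  rcases abs_cases (signedArea A B P) with ⟨h1, h2⟩ | ⟨h1, h2⟩ <;>
    rcases abs_cases (signedArea A B C) with ⟨h3, h4⟩ | ⟨h3, h4⟩ <;> rw [h1, h3] <;> nlinarith

/-- On the triangle, the distance sum agrees up to a factor with an affine function. -/
lemma distSum_mul_signedArea {A B C P : EuclideanSpace ℝ (Fin 2)}
    (hAB : A ≠ B) (hBC : B ≠ C) (hCA : C ≠ A)
    (hP : P ∈ convexHull ℝ ({A, B, C} : Set (EuclideanSpace ℝ (Fin 2)))) :
    distSum A B C P * signedArea A B C = |signedArea A B C| *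
      (signedArea A B P * (dist A B)⁻¹ + signedArea B C P * (dist B C)⁻¹ +
        signedArea C A P * (dist C A)⁻¹) := by
  have hP' : P ∈ convexHull ℝ ({B, C, A} : Set (EuclideanSpace ℝ (Fin 2))) := by
    convert hP using 2; ext; simp; tauto
  have hP'' : P ∈ convexHull ℝ ({C, A, B} : Set (EuclideanSpace ℝ (Fin 2))) := by
    convert hP using 2; ext; simp; tauto
  have h1 := abs_signedArea_mul_of_mem_convexHull hP
  have h2 := abs_signedArea_mul_of_mem_convexHull hP'
  have h3 := abs_signedArea_mul_of_mem_convexHull hP''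
  rw [signedArea_rotate A B C] at h2
  rw [signedArea_rotate B C A, signedArea_rotate A B C] at h3
  simp only [distSum, lineDist_eq_abs_signedArea_div hAB, lineDist_eq_abs_signedArea_div hBC,
    lineDist_eq_abs_signedArea_div hCA, div_eq_mul_inv]
  linear_combination (dist A B)⁻¹ * h1 + (dist B C)⁻¹ * h2 + (dist C A)⁻¹ * h3

/-- A linear system in the plane with nonzero determinant has only the trivial solution. -/
lemma eq_zero_and_eq_zero_of_det_ne_zero {a b c d x y : ℝ} (hdet : a * d - b * c ≠ 0)
    (h1 : a * x + b * y = 0) (h2 : c * x + d * y = 0) : x = 0 ∧ y = 0 := by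
  constructor <;> refine (mul_eq_zero.1 ?_).resolve_left hdet
  · linear_combination d * h1 - b * h2
  · linear_combination a * h2 - c * h1

theorem equilateral_of_three_noncollinear_equal_values
    (A B C : EuclideanSpace ℝ (Fin 2))
    (hncol : ¬ Collinear ℝ ({A, B, C} : Set (EuclideanSpace ℝ (Fin 2))))
    (P₁ P₂ P₃ : EuclideanSpace ℝ (Fin 2))
    (hP₁ : P₁ ∈ convexHull ℝ ({A, B, C} : Set (EuclideanSpace ℝ (Fin 2))))
    (hP₂ : P₂ ∈ convexHull ℝ ({A, B, C} : Set (EuclideanSpace ℝ (Fin 2))))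
    (hP₃ : P₃ ∈ convexHull ℝ ({A, B, C} : Set (EuclideanSpace ℝ (Fin 2))))
    (hPncol : ¬ Collinear ℝ ({P₁, P₂, P₃} : Set (EuclideanSpace ℝ (Fin 2))))
    (h12 : distSum A B C P₁ = distSum A B C P₂)
    (h23 : distSum A B C P₂ = distSum A B C P₃) :
    dist A B = dist B C ∧ dist B C = dist C A := by
  have hK : signedArea A B C ≠ 0 := fun h => hncol (collinear_of_signedArea_eq_zero h)
  have hL : signedArea P₁ P₂ P₃ ≠ 0 := fun h => hPncol (collinear_of_signedArea_eq_zero h)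
  have hAB : A ≠ B := by rintro rfl; simp [signedArea] at hK
  have hBC : B ≠ C := by rintro rfl; simp [signedArea, mul_comm] at hK
  have hCA : C ≠ A := by rintro rfl; simp [signedArea] at hK
  have e1 := distSum_mul_signedArea hAB hBC hCA hP₁
  have e2 := distSum_mul_signedArea hAB hBC hCA hP₂
  have e3 := distSum_mul_signedArea hAB hBC hCA hP₃
  rw [h12, e2] at e1
  rw [← h23, e2] at e3
  replace e1 := mul_left_cancel₀ (abs_ne_zero.2 hK) e1
  replace e3 := mul_left_cancel₀ (abs_ne_zero.2 hK) e3
  suffices h : (dist A B)⁻¹ - (dist C A)⁻¹ = 0 ∧ (dist B C)⁻¹ - (dist C A)⁻¹ = 0 by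
    have h1 := inv_injective (sub_eq_zero.1 h.1)
    have h2 := inv_injective (sub_eq_zero.1 h.2)
    exact ⟨h1.trans h2.symm, h2⟩
  generalize (dist A B)⁻¹ = u at *
  generalize (dist B C)⁻¹ = v at *
  generalize (dist C A)⁻¹ = w at *
  unfold signedArea at e1 e3 hK hL
  obtain ⟨hx, hy⟩ := eq_zero_and_eq_zero_of_det_ne_zero
    (x := (B 1 - A 1) * u + (C 1 - B 1) * v + (A 1 - C 1) * w)
    (y := (B 0 - A 0) * u + (C 0 - B 0) * v + (A 0 - C 0) * w)
    (a := P₂ 0 - P₁ 0) (b := -(P₂ 1 - P₁ 1)) (c := P₃ 0 - P₁ 0) (d := -(P₃ 1 - P₁ 1))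
    (fun h => hL (by linear_combination -h))
    (by linear_combination -e1) (by linear_combination e3 - e1)
  refine eq_zero_and_eq_zero_of_det_ne_zero
    (a := B 0 - A 0) (b := C 0 - B 0) (c := B 1 - A 1) (d := C 1 - B 1)
    (fun h => hK (by linear_combination h))
    (by linear_combination hy) (by linear_combination hx)
end

section
/- Let A, B, C be three non-collinear points in ℝ², let S(P) = dist(P, line AB)² + dist(P, line BC)² + dist(P, line CA)², and let m be the infimum of S over ℝ². Then for every k > m, the level set {P ∈ ℝ² : S(P) = k} is a circle (i.e. equals Metric.sphere c r for some center c ∈ ℝ² and radius r > 0) if and only if the triangle is equilateral: dist A B = dist B C = dist C A. -/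
noncomputable def sqDistSum (A B C P : EuclideanSpace ℝ (Fin 2)) : ℝ :=
  lineDist P A B ^ 2 + lineDist P B C ^ 2 + lineDist P C A ^ 2

/-- Twice the signed area of the triangle `P`, `A`, `B`. -/
def cross (P A B : EuclideanSpace ℝ (Fin 2)) : ℝ :=
  (B 0 - A 0) * (P 1 - A 1) - (B 1 - A 1) * (P 0 - A 0)

/-- The squared distance between two points, in coordinates. -/
def sqLength (A B : EuclideanSpace ℝ (Fin 2)) : ℝ :=
  (B 0 - A 0) ^ 2 + (B 1 - A 1) ^ 2

theorem dist_eq_sqrt_sqLength (A B : EuclideanSpace ℝ (Fin 2)) :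
    dist A B = √(sqLength A B) := by
  rw [EuclideanSpace.dist_eq, Fin.sum_univ_two, Real.dist_eq, Real.dist_eq, sq_abs, sq_abs,
    sqLength]
  congr 1
  ring

theorem sqLength_nonneg (A B : EuclideanSpace ℝ (Fin 2)) : 0 ≤ sqLength A B := by
  unfold sqLength
  positivity

theorem dist_eq_dist_iff_sqLength (A B C D : EuclideanSpace ℝ (Fin 2)) :
    dist A B = dist C D ↔ sqLength A B = sqLength C D := by
  rw [dist_eq_sqrt_sqLength, dist_eq_sqrt_sqLength,
    Real.sqrt_inj (sqLength_nonneg _ _) (sqLength_nonneg _ _)]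

theorem lineDist_sq (P A B : EuclideanSpace ℝ (Fin 2)) (h : 0 < sqLength A B) :
    lineDist P A B ^ 2 = cross P A B ^ 2 / sqLength A B := by
  have key : lineDist P A B = √(cross P A B ^ 2 / sqLength A B) := by
    apply le_antisymm
    · let t : ℝ :=
        ((P 0 - A 0) * (B 0 - A 0) + (P 1 - A 1) * (B 1 - A 1)) / sqLength A B
      have ht : t * sqLength A B =
          (P 0 - A 0) * (B 0 - A 0) + (P 1 - A 1) * (B 1 - A 1) := div_mul_cancel₀ _ h.ne'
      refine (Metric.infDist_le_dist_of_mem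
        (AffineMap.lineMap_mem_affineSpan_pair t A B)).trans ?_
      rw [dist_eq_sqrt_sqLength]
      apply Real.sqrt_le_sqrt
      rw [le_div_iff₀ h]
      simp only [sqLength, cross, AffineMap.lineMap_apply, vsub_eq_sub, vadd_eq_add,
        PiLp.add_apply, PiLp.smul_apply, PiLp.sub_apply, smul_eq_mul] at ht ⊢
      apply le_of_eq
      linear_combination (t * ((B 0 - A 0) ^ 2 + (B 1 - A 1) ^ 2) -
        ((P 0 - A 0) * (B 0 - A 0) + (P 1 - A 1) * (B 1 - A 1))) * ht
    · refine (Metric.le_infDist ⟨A, left_mem_affineSpan_pair ℝ A B⟩).2 ?_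
      intro y hy
      obtain ⟨t, rfl⟩ := mem_affineSpan_pair_iff_exists_lineMap_eq.1 hy
      rw [dist_eq_sqrt_sqLength]
      apply Real.sqrt_le_sqrt
      rw [div_le_iff₀ h]
      simp only [sqLength, cross, AffineMap.lineMap_apply, vsub_eq_sub, vadd_eq_add,
        PiLp.add_apply, PiLp.smul_apply, PiLp.sub_apply, smul_eq_mul]
      nlinarith [sq_nonneg (t * ((B 0 - A 0) ^ 2 + (B 1 - A 1) ^ 2) -
        ((P 0 - A 0) * (B 0 - A 0) + (P 1 - A 1) * (B 1 - A 1)))]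
  rw [key, Real.sq_sqrt (div_nonneg (sq_nonneg _) h.le)]

theorem cross_ne_zero_of_not_collinear {A B C : EuclideanSpace ℝ (Fin 2)}
    (h : ¬ Collinear ℝ ({A, B, C} : Set (EuclideanSpace ℝ (Fin 2)))) :
    cross C A B ≠ 0 := by
  intro h0
  apply h
  rcases eq_or_ne A B with rfl | hAB
  · simpa using collinear_pair ℝ A C
  have hL : 0 < sqLength A B := by
    have := dist_pos.2 hAB
    rwa [dist_eq_sqrt_sqLength, Real.sqrt_pos] at this
  have hC : C ∈ affineSpan ℝ {A, B} := by
    rw [mem_affineSpan_pair_iff_exists_lineMap_eq]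
    refine ⟨((C 0 - A 0) * (B 0 - A 0) + (C 1 - A 1) * (B 1 - A 1)) / sqLength A B, ?_⟩
    ext i
    fin_cases i <;>
      simp only [AffineMap.lineMap_apply, vsub_eq_sub, vadd_eq_add, Fin.zero_eta, Fin.mk_one,
        PiLp.add_apply, PiLp.smul_apply, PiLp.sub_apply, smul_eq_mul] <;>
      field_simp <;> simp only [sqLength, cross] at h0 ⊢
    · linear_combination (B 1 - A 1) * h0
    · linear_combination -(B 0 - A 0) * h0
  have := collinear_insert_of_mem_affineSpan_pair hC
  rwa [Set.insert_comm, Set.pair_comm] at this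

theorem sqLength_pos_of_cross_ne_zero {P A B : EuclideanSpace ℝ (Fin 2)}
    (h : cross P A B ≠ 0) : 0 < sqLength A B := by
  refine (sqLength_nonneg A B).lt_of_ne' fun h0 => h ?_
  unfold sqLength at h0
  have h1 : B 0 - A 0 = 0 := by nlinarith [sq_nonneg (B 0 - A 0), sq_nonneg (B 1 - A 1)]
  have h2 : B 1 - A 1 = 0 := by nlinarith [sq_nonneg (B 0 - A 0), sq_nonneg (B 1 - A 1)]
  simp [cross, h1, h2]

theorem cross_rotate (A B C : EuclideanSpace ℝ (Fin 2)) : cross A B C = cross C A B := by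
  unfold cross
  ring

theorem sqDistSum_eq {A B C : EuclideanSpace ℝ (Fin 2)} (h : cross C A B ≠ 0)
    (P : EuclideanSpace ℝ (Fin 2)) :
    sqDistSum A B C P = cross P A B ^ 2 / sqLength A B + cross P B C ^ 2 / sqLength B C +
      cross P C A ^ 2 / sqLength C A := by
  have h1 : cross A B C ≠ 0 := by rwa [cross_rotate]
  have h2 : cross B C A ≠ 0 := by rwa [cross_rotate]
  rw [sqDistSum, lineDist_sq _ _ _ (sqLength_pos_of_cross_ne_zero h),
    lineDist_sq _ _ _ (sqLength_pos_of_cross_ne_zero h1),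
    lineDist_sq _ _ _ (sqLength_pos_of_cross_ne_zero h2)]

theorem sum_sq_eq_of_equilateral {p q s t L : ℝ} (h1 : p ^ 2 + q ^ 2 = L)
    (h2 : s ^ 2 + t ^ 2 = L) (h3 : (p + s) ^ 2 + (q + t) ^ 2 = L) (hL : L ≠ 0) :
    p ^ 2 + s ^ 2 + (p + s) ^ 2 = q ^ 2 + t ^ 2 + (q + t) ^ 2 ∧
      p * q + s * t + (p + s) * (q + t) = 0 := by
  constructor <;> apply mul_left_cancel₀ hL
  · linear_combination 2 * ((p * s - q * t) * (h3 - h1 - h2) -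
      (p ^ 2 - q ^ 2) * h2 - (s ^ 2 - t ^ 2) * h1)
  · linear_combination (p * t + q * s) * (h3 - h1 - h2) - 2 * p * q * h2 - 2 * s * t * h1

theorem sqLength_eq_of_isotropic {p q s t M₁ M₂ M₃ : ℝ} (hD : p * t - q * s ≠ 0)
    (h1 : (p ^ 2 + q ^ 2) * M₁ = 1) (h2 : (s ^ 2 + t ^ 2) * M₂ = 1)
    (h3 : ((p + s) ^ 2 + (q + t) ^ 2) * M₃ = 1)
    (hdiag : q ^ 2 * M₁ + t ^ 2 * M₂ + (q + t) ^ 2 * M₃ =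
      p ^ 2 * M₁ + s ^ 2 * M₂ + (p + s) ^ 2 * M₃)
    (hoff : p * q * M₁ + s * t * M₂ + (p + s) * (q + t) * M₃ = 0) :
    p ^ 2 + q ^ 2 = s ^ 2 + t ^ 2 ∧ s ^ 2 + t ^ 2 = (p + s) ^ 2 + (q + t) ^ 2 := by
  have hx : p ^ 2 * M₁ + s ^ 2 * M₂ + (p + s) ^ 2 * M₃ = 3 / 2 := by linarith
  have hy : q ^ 2 * M₁ + t ^ 2 * M₂ + (q + t) ^ 2 * M₃ = 3 / 2 := by linarith
  have k1 : (p * t - q * s) ^ 2 * (M₂ + M₃) = 3 / 2 * (p ^ 2 + q ^ 2) := by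
    linear_combination p ^ 2 * hy + q ^ 2 * hx - 2 * p * q * hoff
  have k2 : (p * t - q * s) ^ 2 * (M₁ + M₃) = 3 / 2 * (s ^ 2 + t ^ 2) := by
    linear_combination s ^ 2 * hy + t ^ 2 * hx - 2 * s * t * hoff
  have k3 : (p * t - q * s) ^ 2 * (M₁ + M₂) = 3 / 2 * ((p + s) ^ 2 + (q + t) ^ 2) := by
    linear_combination (p + s) ^ 2 * hy + (q + t) ^ 2 * hx - 2 * (p + s) * (q + t) * hoff
  generalize p ^ 2 + q ^ 2 = L₁ at h1 k1 ⊢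
  generalize s ^ 2 + t ^ 2 = L₂ at h2 k2 ⊢
  generalize (p + s) ^ 2 + (q + t) ^ 2 = L₃ at h3 k3 ⊢
  have hD2 : (p * t - q * s) ^ 2 ≠ 0 := pow_ne_zero 2 hD
  generalize (p * t - q * s) ^ 2 = E at *
  have m1 : E * (L₂ + L₃) = 3 / 2 * (L₁ * L₂ * L₃) := by
    linear_combination L₂ * L₃ * k1 - E * L₃ * h2 - E * L₂ * h3
  have m2 : E * (L₁ + L₃) = 3 / 2 * (L₁ * L₂ * L₃) := by
    linear_combination L₁ * L₃ * k2 - E * L₃ * h1 - E * L₁ * h3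
  have m3 : E * (L₁ + L₂) = 3 / 2 * (L₁ * L₂ * L₃) := by
    linear_combination L₁ * L₂ * k3 - E * L₂ * h1 - E * L₁ * h2
  constructor <;> apply mul_left_cancel₀ hD2 <;> linarith

/-- In an equilateral triangle the squared-distance sum is, up to an additive constant,
a multiple of the squared distance to the centroid. -/
theorem sqDistSum_eq_of_equilateral {A B C : EuclideanSpace ℝ (Fin 2)} (h : cross C A B ≠ 0)
    (h1 : sqLength A B = sqLength B C) (h2 : sqLength B C = sqLength C A)
    (P : EuclideanSpace ℝ (Fin 2)) :
    sqDistSum A B C P =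
      3 / 2 * sqLength P ((1 / 3 : ℝ) • (A + B + C)) + cross C A B ^ 2 / (3 * sqLength C A) := by
  have hL : 0 < sqLength C A := h2 ▸ h1 ▸ sqLength_pos_of_cross_ne_zero h
  rw [sqDistSum_eq h, h1, h2]
  obtain ⟨e1, e2⟩ := sum_sq_eq_of_equilateral (p := B 0 - A 0) (q := B 1 - A 1)
    (s := C 0 - B 0) (t := C 1 - B 1) (L := sqLength C A) (h1.trans h2) h2
    (by unfold sqLength; ring) hL.ne'
  field_simp
  have e0 : (B 0 - A 0) ^ 2 + (C 0 - B 0) ^ 2 + (A 0 - C 0) ^ 2 +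
      ((B 1 - A 1) ^ 2 + (C 1 - B 1) ^ 2 + (A 1 - C 1) ^ 2) = 3 * sqLength C A := by
    have h3 : sqLength A B + sqLength B C + sqLength C A = 3 * sqLength C A := by
      rw [h1, h2]
      ring
    rw [← h3]
    simp only [sqLength]
    ring
  generalize sqLength C A = L at *
  simp only [sqLength, cross, PiLp.add_apply, PiLp.smul_apply, smul_eq_mul] at *
  linear_combination
    3 * (P 0 - 1 / 3 * (A 0 + B 0 + C 0)) ^ 2 * (e0 - e1) +
    3 * (P 1 - 1 / 3 * (A 1 + B 1 + C 1)) ^ 2 * (e0 + e1) -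
    12 * (P 0 - 1 / 3 * (A 0 + B 0 + C 0)) * (P 1 - 1 / 3 * (A 1 + B 1 + C 1)) * e2

/-- If the squared-distance sum is constant on a circle, then the triangle is equilateral. -/
theorem equilateral_of_sqDistSum_eq_on_sphere {A B C c : EuclideanSpace ℝ (Fin 2)} {r k : ℝ}
    (h : cross C A B ≠ 0) (hr : 0 < r) (hS : ∀ P ∈ Metric.sphere c r, sqDistSum A B C P = k) :
    sqLength A B = sqLength B C ∧ sqLength B C = sqLength C A := by
  have hS' : ∀ u v : ℝ, u ^ 2 + v ^ 2 = 1 →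
      sqDistSum A B C !₂[c 0 + r * u, c 1 + r * v] = k := by
    intro u v huv
    apply hS
    rw [Metric.mem_sphere, dist_eq_sqrt_sqLength,
      Real.sqrt_eq_iff_eq_sq (sqLength_nonneg _ _) hr.le]
    simp only [sqLength, Matrix.cons_val_zero, Matrix.cons_val_one]
    linear_combination r ^ 2 * huv
  have p1 := hS' 1 0 (by norm_num)
  have p2 := hS' (-1) 0 (by norm_num)
  have p3 := hS' 0 1 (by norm_num)
  have p4 := hS' 0 (-1) (by norm_num)
  have p5 := hS' (3 / 5) (4 / 5) (by norm_num)
  have p6 := hS' (-(3 / 5)) (-(4 / 5)) (by norm_num)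
  have l1 := sqLength_pos_of_cross_ne_zero h
  have l2 := sqLength_pos_of_cross_ne_zero (P := A) (A := B) (B := C) (by rwa [cross_rotate])
  have l3 := sqLength_pos_of_cross_ne_zero (P := B) (A := C) (B := A)
    (by rwa [cross_rotate, cross_rotate])
  have hr2 : r ^ 2 ≠ 0 := by positivity
  have i1 := mul_inv_cancel₀ l1.ne'
  have i2 := mul_inv_cancel₀ l2.ne'
  have i3 := mul_inv_cancel₀ l3.ne'
  simp only [sqDistSum_eq h, div_eq_mul_inv] at p1 p2 p3 p4 p5 p6
  generalize (sqLength A B)⁻¹ = M₁ at *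
  generalize (sqLength B C)⁻¹ = M₂ at *
  generalize (sqLength C A)⁻¹ = M₃ at *
  simp only [sqLength, cross, Matrix.cons_val_zero, Matrix.cons_val_one] at *
  have := sqLength_eq_of_isotropic (p := B 0 - A 0) (q := B 1 - A 1) (s := C 0 - B 0)
    (t := C 1 - B 1) (M₁ := M₁) (M₂ := M₂) (M₃ := M₃) (by contrapose! h; linarith) i1 i2
    (by linear_combination i3)
    (by
      apply mul_left_cancel₀ hr2
      linear_combination (p1 + p2 - p3 - p4) / 2)
    (by
      apply mul_left_cancel₀ hr2
      linear_combination
        (25 / 48) * ((9 / 25) * (p1 + p2) + (16 / 25) * (p3 + p4) - p5 - p6))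
  refine ⟨this.1, this.2.trans ?_⟩
  ring

theorem sqDistSum_level_set_circle_iff_equilateral
    (A B C : EuclideanSpace ℝ (Fin 2))
    (hncol : ¬ Collinear ℝ ({A, B, C} : Set (EuclideanSpace ℝ (Fin 2))))
    (m : ℝ) (hm : IsGLB (Set.range (sqDistSum A B C)) m) :
    ∀ k : ℝ, m < k →
      ((∃ (c : EuclideanSpace ℝ (Fin 2)) (r : ℝ), 0 < r ∧
          {P : EuclideanSpace ℝ (Fin 2) | sqDistSum A B C P = k} = Metric.sphere c r) ↔
        (dist A B = dist B C ∧ dist B C = dist C A)) := by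
  intro k hk
  have h := cross_ne_zero_of_not_collinear hncol
  rw [dist_eq_dist_iff_sqLength, dist_eq_dist_iff_sqLength]
  constructor
  · rintro ⟨c, r, hr, hset⟩
    exact equilateral_of_sqDistSum_eq_on_sphere h hr fun P hP => hset.symm.subset hP
  · rintro ⟨h1, h2⟩
    have hS := sqDistSum_eq_of_equilateral h h1 h2
    generalize (1 / 3 : ℝ) • (A + B + C) = G at hS
    generalize cross C A B ^ 2 / (3 * sqLength C A) = K at hS
    have hleast : IsLeast (Set.range (sqDistSum A B C)) K := by
      refine ⟨⟨G, by simp [hS, sqLength]⟩, ?_⟩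
      rintro _ ⟨P, rfl⟩
      linarith [hS P, sqLength_nonneg P G]
    obtain rfl : m = K := hm.unique hleast.isGLB
    have hpos : 0 < 2 / 3 * (k - m) := by linarith
    refine ⟨G, √(2 / 3 * (k - m)), Real.sqrt_pos.2 hpos, ?_⟩
    ext P
    rw [Metric.mem_sphere, dist_eq_sqrt_sqLength, Real.sqrt_inj (sqLength_nonneg _ _) hpos.le,
      Set.mem_ofPred_eq, hS]
    constructor <;> intro h <;> linarith
end
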